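/- (Dudley entropy integral bound) Let F be a class of real-valued functions taking values in [0,1] with the zero function 0 ∈ F, and let S = (x_1,...,x_n) be a fixed sample. Then the empirical Rademacher complexity satisfies R̂_S(F) ≤ inf_{α>0} ( 4α/√n + (12/n) ∫_α^{√n} √( log N(F_{|S}, ε, ‖·‖_2) ) dε ), where F_{|S} := {(f(x_1),...,f(x_n)) : f ∈ F} ⊆ R^n. -/

import Mathlib

open Finset ENNReal NNReal MeasureTheory

/-- Covering number of a set `S` w.r.t. a distance function `d` at scale `ε`. -/
noncomputable def coveringNumber {E : Type*} (d : E → E → ℝ) (S : Set E) (ε : ℝ) : ℝ≥0∞ :=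
  ⨅ (C : Finset E) (_ : ∀ x ∈ S, ∃ c ∈ C, d x c ≤ ε), (C.card : ℝ≥0∞)

/-- Euclidean distance between two real vectors. -/
noncomputable def empDistReal {n : ℕ} (u v : Fin n → ℝ) : ℝ :=
  Real.sqrt (∑ i, (u i - v i) ^ 2)

/-- Empirical Rademacher complexity of a class `𝓕` of real-valued functions on the
sample `x`: `E_ε[ sup_{f ∈ 𝓕} (1/n) Σ_i ε_i f(x_i) ]`, where the expectation is the
uniform average over all sign vectors `ε ∈ {±1}^n`. -/
noncomputable def empRademacher {X : Type*} (n : ℕ) (𝓕 : Set (X → ℝ)) (x : Fin n → X) : ℝ :=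
  (1 / 2 ^ n : ℝ) * ∑ e : Fin n → Bool,
    sSup {v : ℝ | ∃ f ∈ 𝓕,
      v = (1 / n : ℝ) * ∑ i, (if e i then (1 : ℝ) else -1) * f (x i)}

/-- The real number `±1` encoded by a Boolean. -/
noncomputable def boolSign (b : Bool) : ℝ := if b then 1 else -1

lemma boolSign_sq (b : Bool) : boolSign b ^ 2 = 1 := by
  cases b <;> simp [boolSign]

lemma sum_boolSign_mul_le {n : ℕ} (e : Fin n → Bool) (v : Fin n → ℝ) :
    ∑ i, boolSign (e i) * v i ≤ Real.sqrt n * Real.sqrt (∑ i, v i ^ 2) := by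
  have h := Real.sum_mul_le_sqrt_mul_sqrt Finset.univ (fun i => boolSign (e i)) v
  simpa [boolSign_sq] using h

lemma empDistReal_eq_dist {n : ℕ} (u v : Fin n → ℝ) :
    empDistReal u v = dist (WithLp.toLp 2 u) (WithLp.toLp 2 v) := by
  simp [empDistReal, EuclideanSpace.dist_eq, Real.dist_eq, sq_abs]

lemma empDistReal_le_sqrt_mul {n : ℕ} {u v : Fin n → ℝ} {δ : ℝ} (hδ : 0 ≤ δ)
    (h : ∀ i, |u i - v i| ≤ δ) : empDistReal u v ≤ Real.sqrt n * δ := by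
  unfold empDistReal
  rw [Real.sqrt_le_left (by positivity), mul_pow, Real.sq_sqrt (Nat.cast_nonneg n)]
  calc ∑ i, (u i - v i) ^ 2 ≤ ∑ _i : Fin n, δ ^ 2 :=
        Finset.sum_le_sum fun i _ => sq_le_sq.2 (by simpa [abs_of_nonneg hδ] using h i)
    _ = n * δ ^ 2 := by simp

lemma sum_exp_boolSign_le {n : ℕ} (a : Fin n → ℝ) (t : ℝ) :
    ∑ e : Fin n → Bool, Real.exp (t * ∑ i, boolSign (e i) * a i)
      ≤ 2 ^ n * Real.exp (t ^ 2 * (∑ i, a i ^ 2) / 2) := by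
  calc ∑ e : Fin n → Bool, Real.exp (t * ∑ i, boolSign (e i) * a i)
      = ∑ e : Fin n → Bool, ∏ i, Real.exp (t * (boolSign (e i) * a i)) := by
        simp only [Finset.mul_sum, Real.exp_sum]
    _ = ∏ i, ∑ b : Bool, Real.exp (t * (boolSign b * a i)) := by
        rw [Finset.prod_univ_sum, Fintype.piFinset_univ]
    _ = ∏ i, (2 * Real.cosh (t * a i)) := by
        refine Finset.prod_congr rfl fun i _ => ?_
        rw [Real.cosh_eq]
        simp [boolSign]
        ring
    _ ≤ ∏ i, (2 * Real.exp ((t * a i) ^ 2 / 2)) := by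
        refine Finset.prod_le_prod (fun i _ => by positivity) fun i _ => ?_
        gcongr
        exact Real.cosh_le_exp_half_sq _
    _ = 2 ^ n * Real.exp (t ^ 2 * (∑ i, a i ^ 2) / 2) := by
        rw [Finset.prod_mul_distrib, ← Real.exp_sum]
        simp [mul_pow, Finset.mul_sum, Finset.sum_div]

/-- If `t * M ≤ L + t² r² / 2` for all `t > 0`, then `M ≤ r √(2L)`. -/
lemma le_mul_sqrt_of_forall_mul_le {M L r : ℝ} (hr : 0 ≤ r) (hL : 0 ≤ L)
    (h : ∀ t : ℝ, 0 < t → t * M ≤ L + t ^ 2 * r ^ 2 / 2) : M ≤ r * Real.sqrt (2 * L) := by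
  rcases le_or_gt M 0 with hM | hM
  · exact hM.trans (by positivity)
  rcases hr.eq_or_lt with rfl | hr
  · have := h ((L + 1) / M) (by positivity)
    rw [div_mul_cancel₀ _ hM.ne'] at this
    linarith
  · have := h (M / r ^ 2) (by positivity)
    have h2 : M ^ 2 ≤ r ^ 2 * (2 * L) := by
      field_simp at this
      nlinarith
    calc M ≤ Real.sqrt (r ^ 2 * (2 * L)) := Real.le_sqrt_of_sq_le h2
      _ = r * Real.sqrt (2 * L) := by
        rw [Real.sqrt_mul (sq_nonneg r), Real.sqrt_sq hr.le]

/-- **Massart's finite class lemma.** -/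
lemma massart_finite_class {n : ℕ} (A : Finset (Fin n → ℝ)) (hA : A.Nonempty) {r : ℝ}
    (hr : 0 ≤ r) (h : ∀ a ∈ A, ∑ i, a i ^ 2 ≤ r ^ 2) :
    (1 / 2 ^ n : ℝ) * ∑ e : Fin n → Bool, A.sup' hA (fun a => ∑ i, boolSign (e i) * a i)
      ≤ r * Real.sqrt (2 * Real.log A.card) := by
  have hcard : (1 : ℝ) ≤ A.card := by exact_mod_cast hA.card_pos
  refine le_mul_sqrt_of_forall_mul_le hr (Real.log_nonneg hcard) fun t ht => ?_
  set m : (Fin n → Bool) → ℝ := fun e => A.sup' hA (fun a => ∑ i, boolSign (e i) * a i)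
  have hjensen : Real.exp (∑ e, (1 / 2 ^ n : ℝ) • (t * m e))
      ≤ ∑ e, (1 / 2 ^ n : ℝ) • Real.exp (t * m e) :=
    convexOn_exp.map_sum_le (fun _ _ => by positivity) (by simp) (by simp)
  have hmax : ∀ e, Real.exp (t * m e)
      ≤ ∑ a ∈ A, Real.exp (t * ∑ i, boolSign (e i) * a i) := by
    intro e
    obtain ⟨a, ha, hae⟩ := Finset.exists_mem_eq_sup' hA (fun a => ∑ i, boolSign (e i) * a i)
    have : m e = ∑ i, boolSign (e i) * a i := hae
    rw [this]
    exact Finset.single_le_sum (f := fun a => Real.exp (t * ∑ i, boolSign (e i) * a i))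
      (fun _ _ => (Real.exp_pos _).le) ha
  have hsum : ∑ e, Real.exp (t * m e) ≤ A.card * (2 ^ n * Real.exp (t ^ 2 * r ^ 2 / 2)) := by
    calc ∑ e, Real.exp (t * m e)
        ≤ ∑ e : Fin n → Bool, ∑ a ∈ A, Real.exp (t * ∑ i, boolSign (e i) * a i) :=
          Finset.sum_le_sum fun e _ => hmax e
      _ = ∑ a ∈ A, ∑ e : Fin n → Bool, Real.exp (t * ∑ i, boolSign (e i) * a i) :=
          Finset.sum_comm
      _ ≤ ∑ _a ∈ A, 2 ^ n * Real.exp (t ^ 2 * r ^ 2 / 2) := by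
          refine Finset.sum_le_sum fun a ha => (sum_exp_boolSign_le a t).trans ?_
          gcongr
          exact h a ha
      _ = _ := by simp
  have hexp : Real.exp (t * ((1 / 2 ^ n : ℝ) * ∑ e, m e))
      ≤ Real.exp (Real.log A.card + t ^ 2 * r ^ 2 / 2) := by
    calc Real.exp (t * ((1 / 2 ^ n : ℝ) * ∑ e, m e))
        = Real.exp (∑ e, (1 / 2 ^ n : ℝ) • (t * m e)) := by
          simp only [smul_eq_mul, ← Finset.mul_sum]
          congr 1
          ring
      _ ≤ (1 / 2 ^ n : ℝ) * ∑ e, Real.exp (t * m e) := by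
          simpa only [smul_eq_mul, ← Finset.mul_sum] using hjensen
      _ ≤ (1 / 2 ^ n : ℝ) * (A.card * (2 ^ n * Real.exp (t ^ 2 * r ^ 2 / 2))) := by gcongr
      _ = Real.exp (Real.log A.card + t ^ 2 * r ^ 2 / 2) := by
          rw [Real.exp_add, Real.exp_log (by linarith)]
          field_simp
  exact Real.exp_le_exp.1 hexp

lemma coveringNumber_le_card {E : Type*} {d : E → E → ℝ} {S : Set E} {ε : ℝ} {C : Finset E}
    (hC : ∀ x ∈ S, ∃ c ∈ C, d x c ≤ ε) : coveringNumber d S ε ≤ C.card :=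
  iInf₂_le C hC

lemma coveringNumber_antitone {E : Type*} (d : E → E → ℝ) (S : Set E) :
    Antitone (coveringNumber d S) := fun _ _ h =>
  le_iInf₂ fun _ hC => coveringNumber_le_card fun x hx =>
    let ⟨c, hc, hd⟩ := hC x hx
    ⟨c, hc, hd.trans h⟩

lemma one_le_coveringNumber {E : Type*} (d : E → E → ℝ) {S : Set E} (hS : S.Nonempty) (ε : ℝ) :
    1 ≤ coveringNumber d S ε := by
  refine le_iInf₂ fun C hC => ?_
  obtain ⟨x, hx⟩ := hS
  obtain ⟨c, hc, -⟩ := hC x hx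
  exact_mod_cast Finset.card_pos.2 ⟨c, hc⟩

lemma exists_cover_card_eq_coveringNumber {E : Type*} {d : E → E → ℝ} {S : Set E} {ε : ℝ}
    (h : coveringNumber d S ε ≠ ∞) :
    ∃ C : Finset E, (∀ x ∈ S, ∃ c ∈ C, d x c ≤ ε) ∧
      (C.card : ℝ) = (coveringNumber d S ε).toReal := by
  have hne : {C : Finset E | ∀ x ∈ S, ∃ c ∈ C, d x c ≤ ε}.Nonempty := by
    by_contra hempty
    rw [Set.not_nonempty_iff_eq_empty, Set.eq_empty_iff_forall_notMem] at hempty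
    exact h (iInf₂_eq_top.2 fun C hC => (hempty C hC).elim)
  obtain ⟨C, hC, hmin⟩ := exists_minimalFor_of_wellFoundedLT _ Finset.card hne
  refine ⟨C, hC, ?_⟩
  have : coveringNumber d S ε = C.card := by
    refine le_antisymm (coveringNumber_le_card hC) (le_iInf₂ fun D hD => ?_)
    exact_mod_cast (le_total C.card D.card).elim id (hmin hD)
  simp [this]

lemma coveringNumber_empDistReal_ne_top {n : ℕ} (hn : 0 < n) {S : Set (Fin n → ℝ)}
    (hS : Bornology.IsBounded S) {ε : ℝ} (hε : 0 < ε) :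
    coveringNumber empDistReal S ε ≠ ∞ := by
  have hb : 0 < Real.sqrt n := Real.sqrt_pos.2 (by exact_mod_cast hn)
  obtain ⟨C, hfin, hC⟩ :=
    Metric.totallyBounded_iff.1 (hS.isCompact_closure.totallyBounded.subset subset_closure) (ε / Real.sqrt n) (by positivity)
  refine ne_top_of_le_ne_top (ENNReal.natCast_ne_top hfin.toFinset.card)
    (coveringNumber_le_card fun x hx => ?_)
  obtain ⟨c, hc, hxc⟩ := Set.mem_iUnion₂.1 (hC hx)
  refine ⟨c, hfin.mem_toFinset.2 hc, ?_⟩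
  have hd : dist x c < ε / Real.sqrt n := hxc
  calc empDistReal x c ≤ Real.sqrt n * (ε / Real.sqrt n) :=
        empDistReal_le_sqrt_mul (by positivity) fun i =>
          (dist_le_pi_dist x c i).trans hd.le
    _ = ε := by field_simp

/-- The increments of a multiscale approximation, of length at most `δ`. -/
noncomputable def chainLinks {n : ℕ} (C D : Finset (Fin n → ℝ)) (δ : ℝ) :
    Finset (Fin n → ℝ) :=
  (Finset.image₂ (fun c d => d - c) C D).filter fun a => ∑ i, a i ^ 2 ≤ δ ^ 2

lemma card_chainLinks_le {n : ℕ} (C D : Finset (Fin n → ℝ)) (δ : ℝ) :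
    (chainLinks C D δ).card ≤ C.card * D.card :=
  (Finset.card_filter_le _ _).trans (Finset.card_image₂_le _ _ _)

lemma sub_mem_chainLinks {n : ℕ} {C D : Finset (Fin n → ℝ)} {t c d : Fin n → ℝ} {γ δ : ℝ}
    (hc : c ∈ C) (hd : d ∈ D) (htc : empDistReal t c ≤ γ) (htd : empDistReal t d ≤ δ) :
    d - c ∈ chainLinks C D (γ + δ) := by
  refine Finset.mem_filter.2 ⟨Finset.mem_image₂_of_mem hc hd, ?_⟩
  have hdc : empDistReal d c ≤ γ + δ := by
    rw [empDistReal_eq_dist] at *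
    linarith [dist_triangle_left (WithLp.toLp 2 d) (WithLp.toLp 2 c) (WithLp.toLp 2 t)]
  exact (Real.sqrt_le_iff.1 hdc).2

/-- **Discrete chaining bound** for the Rademacher width of a set. -/
lemma avg_sSup_boolSign_le_chaining {n : ℕ} {S : Set (Fin n → ℝ)} (hS : S.Nonempty)
    (C : ℕ → Finset (Fin n → ℝ)) (r : ℕ → ℝ) (hr : ∀ j, 0 ≤ r j) (hC0 : C 0 = {0})
    (hC : ∀ j, ∀ t ∈ S, ∃ c ∈ C j, empDistReal t c ≤ r j) (N : ℕ) :
    (1 / 2 ^ n : ℝ) * ∑ e : Fin n → Bool,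
        sSup {v : ℝ | ∃ t ∈ S, v = ∑ i, boolSign (e i) * t i}
      ≤ Real.sqrt n * r N + ∑ j ∈ Finset.range N, (r j + r (j + 1)) *
          Real.sqrt (2 * Real.log ((C j).card * (C (j + 1)).card)) := by
  choose! p hpC hp using hC
  set A : ℕ → Finset (Fin n → ℝ) := fun j => chainLinks (C j) (C (j + 1)) (r j + r (j + 1))
  have hmem : ∀ j, ∀ t ∈ S, p (j + 1) t - p j t ∈ A j := fun j t ht =>
    sub_mem_chainLinks (hpC j t ht) (hpC (j + 1) t ht) (hp j t ht) (hp (j + 1) t ht)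
  have hA : ∀ j, (A j).Nonempty := fun j => ⟨_, hmem j _ hS.some_mem⟩
  set m : ℕ → (Fin n → Bool) → ℝ := fun j e =>
    (A j).sup' (hA j) (fun a => ∑ i, boolSign (e i) * a i)
  have hpt : ∀ e : Fin n → Bool, sSup {v : ℝ | ∃ t ∈ S, v = ∑ i, boolSign (e i) * t i}
      ≤ Real.sqrt n * r N + ∑ j ∈ Finset.range N, m j e := by
    intro e
    refine csSup_le ⟨_, _, hS.some_mem, rfl⟩ ?_
    rintro v ⟨t, ht, rfl⟩
    have hp0 : p 0 t = 0 := by simpa [hC0] using hpC 0 t ht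
    have hlink : ∀ k, ∑ i, boolSign (e i) * p k t i ≤ ∑ j ∈ Finset.range k, m j e := by
      intro k
      induction k with
      | zero => simp [hp0]
      | succ k ih =>
        have h1 : ∑ i, boolSign (e i) * (p (k + 1) t - p k t) i ≤ m k e :=
          Finset.le_sup' (fun a => ∑ i, boolSign (e i) * a i) (hmem k t ht)
        simp only [Pi.sub_apply, mul_sub, Finset.sum_sub_distrib] at h1
        rw [Finset.sum_range_succ]
        linarith
    have hrem := sum_boolSign_mul_le e (t - p N t)
    have hdist : Real.sqrt (∑ i, (t - p N t) i ^ 2) ≤ r N := hp N t ht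
    have hscale := mul_le_mul_of_nonneg_left hdist (Real.sqrt_nonneg n)
    simp only [Pi.sub_apply, mul_sub, Finset.sum_sub_distrib] at hrem hscale
    linarith [hlink N]
  calc _ ≤ (1 / 2 ^ n : ℝ) * ∑ e : Fin n → Bool,
          (Real.sqrt n * r N + ∑ j ∈ Finset.range N, m j e) := by
        gcongr with e
        exact hpt e
    _ = Real.sqrt n * r N + ∑ j ∈ Finset.range N, (1 / 2 ^ n : ℝ) * ∑ e, m j e := by
        rw [Finset.sum_add_distrib, Finset.sum_comm, mul_add, Finset.mul_sum (Finset.range N)]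
        simp
    _ ≤ _ := by
        refine add_le_add le_rfl (Finset.sum_le_sum fun j _ => ?_)
        have hcard : (1 : ℝ) ≤ (A j).card := by exact_mod_cast (hA j).card_pos
        refine (massart_finite_class (A j) (hA j) (add_nonneg (hr j) (hr (j + 1)))
          fun a ha => (Finset.mem_filter.1 ha).2).trans ?_
        have := add_nonneg (hr j) (hr (j + 1))
        gcongr
        exact_mod_cast card_chainLinks_le _ _ _

lemma sum_mul_le_integral_of_antitoneOn {g : ℝ → ℝ} (hg : AntitoneOn g (Set.Ioi 0))
    {b : ℝ} (hb : 0 < b) (hnn : ∀ t, 0 ≤ g t) (N : ℕ) :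
    ∑ j ∈ Finset.range N, b / 2 ^ (j + 2) * g (b / 2 ^ (j + 1))
      ≤ ∫ t in (b / 2 ^ (N + 1))..b, g t := by
  have hint : ∀ u v : ℝ, 0 < u → 0 < v → IntervalIntegrable g volume u v := fun u v hu hv =>
    (hg.mono fun t ht => (lt_min hu hv).trans_le ht.1).intervalIntegrable
  induction N with
  | zero =>
    simp only [Finset.range_zero, Finset.sum_empty]
    exact intervalIntegral.integral_nonneg (div_le_self hb.le (by norm_num)) fun t _ => hnn t
  | succ N ih =>
    have hle : b / 2 ^ (N + 2) ≤ b / 2 ^ (N + 1) := by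
      gcongr <;> norm_num
    have hpos : 0 < b / 2 ^ (N + 2) := by positivity
    rw [Finset.sum_range_succ, ← intervalIntegral.integral_add_adjacent_intervals
      (hint (b / 2 ^ (N + 2)) (b / 2 ^ (N + 1)) hpos (by positivity))
      (hint (b / 2 ^ (N + 1)) b (by positivity) hb)]
    have hstep : b / 2 ^ (N + 2) * g (b / 2 ^ (N + 1))
        ≤ ∫ t in (b / 2 ^ (N + 2))..(b / 2 ^ (N + 1)), g t := by
      calc b / 2 ^ (N + 2) * g (b / 2 ^ (N + 1))
          = ∫ _t in (b / 2 ^ (N + 2))..(b / 2 ^ (N + 1)), g (b / 2 ^ (N + 1)) := by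
            rw [intervalIntegral.integral_const, smul_eq_mul]
            congr 1
            field_simp
            ring
        _ ≤ _ := intervalIntegral.integral_mono_on hle (by simp)
            (hint _ _ hpos (by positivity)) fun t ht =>
              hg (hpos.trans_le ht.1) (by simp only [Set.mem_Ioi]; positivity) ht.2
    linarith

/-- Dudley's bound for the Rademacher width of a set of vectors of length at most `√n`. -/
lemma avg_sSup_boolSign_le_entropy_integral {n : ℕ} (hn : 0 < n) {S : Set (Fin n → ℝ)}
    (hS : S.Nonempty) (hball : ∀ t ∈ S, empDistReal t 0 ≤ Real.sqrt n)
    (hbdd : Bornology.IsBounded S) {α : ℝ} (hα : 0 < α) :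
    (1 / 2 ^ n : ℝ) * ∑ e : Fin n → Bool,
        sSup {v : ℝ | ∃ t ∈ S, v = ∑ i, boolSign (e i) * t i}
      ≤ Real.sqrt n * (4 * α) + 12 * ∫ ε in Set.Icc α (Real.sqrt n),
          Real.sqrt (Real.log (coveringNumber empDistReal S ε).toReal) := by
  set b := Real.sqrt n
  have hb : 0 < b := Real.sqrt_pos.2 (by exact_mod_cast hn)
  set g : ℝ → ℝ := fun ε => Real.sqrt (Real.log (coveringNumber empDistReal S ε).toReal)
  have hfin : ∀ ε : ℝ, 0 < ε → coveringNumber empDistReal S ε ≠ ∞ := fun ε hε =>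
    coveringNumber_empDistReal_ne_top hn hbdd hε
  have hone : ∀ ε : ℝ, 0 < ε → 1 ≤ (coveringNumber empDistReal S ε).toReal := fun ε hε => by
    simpa using ENNReal.toReal_mono (hfin ε hε) (one_le_coveringNumber empDistReal hS ε)
  have hanti : ∀ u v : ℝ, 0 < u → u ≤ v →
      (coveringNumber empDistReal S v).toReal ≤ (coveringNumber empDistReal S u).toReal :=
    fun u v hu huv => ENNReal.toReal_mono (hfin u hu) (coveringNumber_antitone _ _ huv)
  have hg : AntitoneOn g (Set.Ioi 0) := fun u hu v hv huv =>
    Real.sqrt_le_sqrt (Real.log_le_log (zero_lt_one.trans_le (hone v hv)) (hanti u v hu huv))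
  have hgnn : ∀ t, 0 ≤ g t := fun t => Real.sqrt_nonneg _
  have hcover : ∀ j : ℕ, ∃ C : Finset (Fin n → ℝ), (j = 0 → C = {0}) ∧
      (∀ t ∈ S, ∃ c ∈ C, empDistReal t c ≤ b / 2 ^ j) ∧
      (C.card : ℝ) ≤ (coveringNumber empDistReal S (b / 2 ^ j)).toReal := by
    intro j
    rcases Nat.eq_zero_or_pos j with rfl | hj
    · exact ⟨{0}, fun _ => rfl, fun t ht => ⟨0, by simp, by simpa using hball t ht⟩,
        by simpa using hone b hb⟩
    · obtain ⟨C, hC, hcard⟩ :=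
        exists_cover_card_eq_coveringNumber (hfin (b / 2 ^ j) (by positivity))
      exact ⟨C, fun h => absurd h hj.ne', hC, hcard.le⟩
  choose C hC0 hC hcard using hcover
  have hCpos : ∀ j, 0 < (C j).card := fun j =>
    let ⟨c, hc, _⟩ := hC j _ hS.some_mem
    Finset.card_pos.2 ⟨c, hc⟩
  have hlog : ∀ j, (b / 2 ^ j + b / 2 ^ (j + 1)) *
      Real.sqrt (2 * Real.log ((C j).card * (C (j + 1)).card))
        ≤ 12 * (b / 2 ^ (j + 2) * g (b / 2 ^ (j + 1))) := by
    intro j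
    set K := (coveringNumber empDistReal S (b / 2 ^ (j + 1))).toReal
    have h0 : ((C j).card : ℝ) ≤ K := (hcard j).trans <| hanti _ _ (by positivity) <| by
      gcongr <;> norm_num
    have h1 : ((C (j + 1)).card : ℝ) ≤ K := hcard (j + 1)
    have hp0 : (0 : ℝ) < (C j).card := by exact_mod_cast hCpos j
    have hp1 : (0 : ℝ) < (C (j + 1)).card := by exact_mod_cast hCpos (j + 1)
    have hKlog : Real.log ((C j).card * (C (j + 1)).card) ≤ 2 * Real.log K := by
      rw [Real.log_mul hp0.ne' hp1.ne']
      linarith [Real.log_le_log hp0 h0, Real.log_le_log hp1 h1]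
    have hsqrt : Real.sqrt (2 * Real.log ((C j).card * (C (j + 1)).card))
        ≤ 2 * g (b / 2 ^ (j + 1)) := by
      calc _ ≤ Real.sqrt (2 ^ 2 * Real.log K) := Real.sqrt_le_sqrt (by linarith)
        _ = 2 * g (b / 2 ^ (j + 1)) := by
          rw [Real.sqrt_mul (by norm_num), Real.sqrt_sq (by norm_num)]
    calc _ ≤ (b / 2 ^ j + b / 2 ^ (j + 1)) * (2 * g (b / 2 ^ (j + 1))) := by gcongr
      _ = _ := by
        field_simp
        ring
  have hchain : ∀ N, (1 / 2 ^ n : ℝ) * ∑ e : Fin n → Bool,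
        sSup {v : ℝ | ∃ t ∈ S, v = ∑ i, boolSign (e i) * t i}
      ≤ b * (b / 2 ^ N) + 12 * ∫ t in (b / 2 ^ (N + 1))..b, g t := by
    intro N
    refine (avg_sSup_boolSign_le_chaining hS C (fun j => b / 2 ^ j) (fun j => by positivity)
      (hC0 0 rfl) hC N).trans (add_le_add le_rfl ?_)
    refine (Finset.sum_le_sum fun j _ => hlog j).trans ?_
    rw [← Finset.mul_sum]
    exact mul_le_mul_of_nonneg_left (sum_mul_le_integral_of_antitoneOn hg hb hgnn N)
      (by norm_num)
  rcases le_or_gt b (4 * α) with hbig | hsmall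
  · have hzero := avg_sSup_boolSign_le_chaining hS C (fun j => b / 2 ^ j)
      (fun j => by positivity) (hC0 0 rfl) hC 0
    have hI : 0 ≤ ∫ ε in Set.Icc α b, g ε := integral_nonneg hgnn
    simp only [pow_zero, div_one, Finset.range_zero, Finset.sum_empty, add_zero] at hzero
    have := mul_le_mul_of_nonneg_left hbig hb.le
    linarith
  · obtain ⟨k, hk⟩ := exists_nat_pow_near (one_le_div (by positivity : 0 < 4 * α) |>.2 hsmall.le)
      (one_lt_two : (1 : ℝ) < 2)
    have hk1 : 4 * α * 2 ^ k ≤ b := by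
      have := hk.1
      rw [le_div_iff₀ (by positivity)] at this
      linarith
    have hk2 : b < 4 * α * 2 ^ (k + 1) := by
      have := hk.2
      rw [div_lt_iff₀ (by positivity)] at this
      linarith
    have hcoarse : b / 2 ^ (k + 1) ≤ 4 * α := by
      rw [div_le_iff₀ (by positivity)]
      exact hk2.le
    have hfine : α ≤ b / 2 ^ (k + 1 + 1) := by
      rw [le_div_iff₀ (by positivity), pow_succ, pow_succ]
      linarith
    have hle : b / 2 ^ (k + 1 + 1) ≤ b := div_le_self hb.le (one_le_pow₀ (by norm_num))
    have hI : ∫ t in (b / 2 ^ (k + 1 + 1))..b, g t ≤ ∫ ε in Set.Icc α b, g ε := by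
      rw [intervalIntegral.integral_of_le hle]
      refine setIntegral_mono_set ?_ (Filter.Eventually.of_forall hgnn)
        (Set.Ioc_subset_Icc_self.trans (Set.Icc_subset_Icc_left hfine)).eventuallyLE
      exact (hg.mono fun t ht => hα.trans_le ht.1).integrableOn_isCompact isCompact_Icc
    have := mul_le_mul_of_nonneg_left hcoarse hb.le
    linarith [hchain (k + 1)]

/-- **Theorem 3 (Dudley entropy integral).** For a class `𝓕` of `[0,1]`-valued
functions containing `0`, the empirical Rademacher complexity is bounded by
`inf_{α>0} (4α/√n + (12/n) ∫_α^{√n} √(log N(𝓕_{|S}, ε, ‖·‖₂)) dε)`. -/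
theorem dudley_entropy_integral
    {X : Type*} (n : ℕ) (hn : 0 < n)
    (𝓕 : Set (X → ℝ))
    (hrange : ∀ f ∈ 𝓕, ∀ x : X, f x ∈ Set.Icc (0 : ℝ) 1)
    (hzero : (fun _ : X => (0 : ℝ)) ∈ 𝓕)
    (x : Fin n → X) :
    empRademacher n 𝓕 x
      ≤ ⨅ α : {a : ℝ // 0 < a},
          4 * (α : ℝ) / Real.sqrt n
            + (12 / n : ℝ) *
              ∫ ε in Set.Icc (α : ℝ) (Real.sqrt n),
                Real.sqrt (Real.log
                  (coveringNumber empDistReal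
                    {v : Fin n → ℝ | ∃ f ∈ 𝓕, v = fun i => f (x i)} ε).toReal) := by
  set S : Set (Fin n → ℝ) := {v | ∃ f ∈ 𝓕, v = fun i => f (x i)}
  have hn' : (0 : ℝ) < n := by exact_mod_cast hn
  have hb : 0 < Real.sqrt n := Real.sqrt_pos.2 hn'
  have hcube : S ⊆ Set.Icc 0 1 := by
    rintro v ⟨f, hf, rfl⟩
    exact ⟨fun i => (hrange f hf (x i)).1, fun i => (hrange f hf (x i)).2⟩
  have hne : S.Nonempty := ⟨_, _, hzero, rfl⟩
  have hball : ∀ t ∈ S, empDistReal t 0 ≤ Real.sqrt n := fun t ht => by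
    have h := hcube ht
    simpa using empDistReal_le_sqrt_mul (u := t) (v := 0) zero_le_one fun i => by
      simpa [abs_of_nonneg (h.1 i)] using h.2 i
  have hwidth : empRademacher n 𝓕 x = (1 / n : ℝ) * ((1 / 2 ^ n : ℝ) * ∑ e : Fin n → Bool,
      sSup {v : ℝ | ∃ t ∈ S, v = ∑ i, boolSign (e i) * t i}) := by
    unfold empRademacher
    rw [mul_left_comm, Finset.mul_sum Finset.univ _ (1 / n : ℝ)]
    congr 1
    refine Finset.sum_congr rfl fun e _ => ?_
    rw [← smul_eq_mul, ← Real.sSup_smul_of_nonneg (by positivity)]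
    congr 1
    ext v
    simp only [Set.mem_ofPred_eq, Set.mem_smul_set, S, boolSign, smul_eq_mul]
    constructor
    · rintro ⟨f, hf, rfl⟩
      exact ⟨_, ⟨_, ⟨f, hf, rfl⟩, rfl⟩, rfl⟩
    · rintro ⟨_, ⟨_, ⟨f, hf, rfl⟩, rfl⟩, rfl⟩
      exact ⟨f, hf, rfl⟩
  have : Nonempty {a : ℝ // 0 < a} := ⟨⟨1, one_pos⟩⟩
  refine le_ciInf fun α => ?_
  have hmain := avg_sSup_boolSign_le_entropy_integral hn hne hball
    ((Metric.isBounded_Icc 0 1).subset hcube) α.2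
  rw [hwidth]
  refine (mul_le_mul_of_nonneg_left hmain (by positivity : (0 : ℝ) ≤ 1 / n)).trans_eq ?_
  rw [mul_add]
  congr 1
  · rw [div_mul_eq_mul_div, one_mul, div_eq_div_iff hn'.ne' hb.ne']
    linear_combination (4 * (α : ℝ)) * Real.mul_self_sqrt hn'.le
  · ring
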